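/- arXiv:1701.01002 — 2 statements merged into one kernel-verified Lean document; each statement's English description precedes it below -/
import Mathlib

section
/- Let A ∈ C₋ with A ≠ ∅ and A ≠ R̄₋ⁿ. Then the copolar is involutive on A: (A°)° = A. -/
open Set MeasureTheory Pointwise

noncomputable section

abbrev En (n : ℕ) := EuclideanSpace ℝ (Fin n)

/-- Standard inner product on ℝⁿ. -/
def dotp {n : ℕ} (x y : En n) : ℝ := ∑ i, x i * y i

/-- Closed positive orthant R̄₊ⁿ. -/
def posOrthantCl (n : ℕ) : Set (En n) := {x | ∀ i, 0 ≤ x i}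
/-- Open positive orthant R₊ⁿ. -/
def posOrthantOp (n : ℕ) : Set (En n) := {x | ∀ i, 0 < x i}
/-- Closed negative orthant R̄₋ⁿ. -/
def negOrthantCl (n : ℕ) : Set (En n) := {x | ∀ i, x i ≤ 0}
/-- Open negative orthant R₋ⁿ. -/
def negOrthantOp (n : ℕ) : Set (En n) := {x | ∀ i, x i < 0}

/-- Copolar A° = {x : ⟨x,y⟩ ≤ −1 for all y ∈ A}. -/
def copolar {n : ℕ} (A : Set (En n)) : Set (En n) := {x | ∀ y ∈ A, dotp x y ≤ -1}

/-- Membership in C₊: closed convex subset of R̄₊ⁿ with A + R₊ⁿ ⊆ A. -/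
def memCplus {n : ℕ} (A : Set (En n)) : Prop :=
  IsClosed A ∧ Convex ℝ A ∧ A ⊆ posOrthantCl n ∧ A + posOrthantOp n ⊆ A

/-- Membership in C₋: closed convex subset of R̄₋ⁿ with A + R₋ⁿ ⊆ A. -/
def memCminus {n : ℕ} (A : Set (En n)) : Prop :=
  IsClosed A ∧ Convex ℝ A ∧ A ⊆ negOrthantCl n ∧ A + negOrthantOp n ⊆ A

/-- Membership in CC₊: member of C₊ with bounded complement in R̄₊ⁿ. -/
def memCCplus {n : ℕ} (P : Set (En n)) : Prop :=
  memCplus P ∧ Bornology.IsBounded (posOrthantCl n \ P)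

/-- Membership in UC₋: nonempty member of C₋ contained in s* + R̄₋ⁿ for some s* ∈ R₋ⁿ. -/
def memUCminus {n : ℕ} (L : Set (En n)) : Prop :=
  L.Nonempty ∧ memCminus L ∧ ∃ s ∈ negOrthantOp n, L ⊆ s +ᵥ negOrthantCl n

/-- Support function of a set, with values in EReal. -/
def suppFn {n : ℕ} (A : Set (En n)) (x : En n) : EReal := ⨆ y ∈ A, ((dotp x y : ℝ) : EReal)

/-- Legendre transform of an EReal-valued function. -/
def legendre {n : ℕ} (f : En n → EReal) (y : En n) : EReal :=
  ⨆ x, ((dotp x y : ℝ) : EReal) - f x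
lemma dotp_eq_inner {n : ℕ} (x y : En n) : dotp x y = inner ℝ x y := by
  simp [dotp, PiLp.inner_apply, mul_comm]

lemma memCminus.add_mem {n : ℕ} {A : Set (En n)} (hA : memCminus A) {a w : En n}
    (ha : a ∈ A) (hw : w ∈ negOrthantCl n) : a + w ∈ A := by
  obtain ⟨hcl, -, -, hadd⟩ := hA
  let u : En n := WithLp.toLp 2 fun _ => -1
  have hlim : Filter.Tendsto (fun ε : ℝ => a + (w + ε • u)) (nhdsWithin 0 (Ioi 0))
      (nhds (a + w)) := by
    have hcont : Continuous fun ε : ℝ => a + (w + ε • u) := by fun_prop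
    simpa using (hcont.tendsto 0).mono_left nhdsWithin_le_nhds
  refine hcl.mem_of_tendsto hlim ?_
  filter_upwards [self_mem_nhdsWithin] with ε hε
  refine hadd (add_mem_add ha fun i => ?_)
  have h1 := hw i
  have h2 : (0 : ℝ) < ε := hε
  simp only [u, PiLp.add_apply, PiLp.smul_apply, smul_eq_mul]
  linarith

lemma memCminus.exists_separating {n : ℕ} {A : Set (En n)} (hA : memCminus A) {z : En n}
    (hz : z ∉ A) : ∃ (v : En n) (s : ℝ), (∀ y ∈ A, inner ℝ v y < s) ∧ s < inner ℝ v z := by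
  obtain ⟨f, s, hf, hs⟩ := geometric_hahn_banach_closed_point hA.2.1 hA.1 hz
  exact ⟨(InnerProductSpace.toDual ℝ (En n)).symm f, s, by simpa using hf, by simpa using hs⟩

lemma memCminus.inner_nonpos {n : ℕ} {A : Set (En n)} (hA : memCminus A) {v : En n} {s : ℝ}
    (hv : ∀ y ∈ A, inner ℝ v y < s) {y : En n} (hy : y ∈ A) : inner ℝ v y ≤ 0 := by
  by_contra! h
  obtain ⟨k, hk⟩ := exists_nat_gt (s / inner ℝ v y)
  rw [div_lt_iff₀ h] at hk
  have hmem : y + (k : ℝ) • y ∈ A := hA.add_mem hy fun i => by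
    simpa using mul_nonpos_of_nonneg_of_nonpos k.cast_nonneg (hA.2.2.1 hy i)
  have := hv _ hmem
  rw [inner_add_right, real_inner_smul_right] at this
  linarith

lemma memCminus.zero_notMem {n : ℕ} {A : Set (En n)} (hA : memCminus A)
    (hne : A ≠ negOrthantCl n) : (0 : En n) ∉ A := fun h0 =>
  hne (hA.2.2.1.antisymm fun w hw => by simpa using hA.add_mem h0 hw)

lemma smul_mem_copolar {n : ℕ} {A : Set (En n)} {v : En n} {s : ℝ} (hs : s < 0)
    (hv : ∀ y ∈ A, inner ℝ v y < s) : (-s)⁻¹ • v ∈ copolar A := by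
  intro y hy
  rw [dotp_eq_inner, real_inner_smul_left, inv_mul_le_iff₀ (neg_pos.2 hs)]
  linarith [hv y hy]

/-- For A ∈ C₋ with A ≠ ∅ and A ≠ R̄₋ⁿ, the copolar is involutive:
(A°)° = A. -/
theorem copolar_copolar_Cminus (n : ℕ) (hn : 1 ≤ n) (A : Set (En n))
    (hA : memCminus A) (hne : A.Nonempty) (hne' : A ≠ negOrthantCl n) :
    copolar (copolar A) = A := by
  apply Subset.antisymm
  · intro z hz
    by_contra hzA
    obtain ⟨v, s, hv, hvz⟩ := hA.exists_separating hzA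
    rcases lt_or_ge s 0 with hs | hs
    · have h := hz _ (smul_mem_copolar hs hv)
      rw [dotp_eq_inner, real_inner_comm, real_inner_smul_left,
        inv_mul_le_iff₀ (neg_pos.2 hs)] at h
      linarith
    · obtain ⟨v₀, s₀, hv₀, hs₀⟩ := hA.exists_separating (hA.zero_notMem hne')
      rw [inner_zero_right] at hs₀
      have hw := smul_mem_copolar hs₀ hv₀
      generalize (-s₀)⁻¹ • v₀ = w at hw
      have hpos : 0 < inner ℝ v z := hs.trans_lt hvz
      obtain ⟨k, hk⟩ := exists_nat_gt ((-1 - inner ℝ w z) / inner ℝ v z)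
      rw [div_lt_iff₀ hpos] at hk
      have hmem : w + (k : ℝ) • v ∈ copolar A := fun y hy => by
        have hwy := hw y hy
        rw [dotp_eq_inner] at hwy ⊢
        rw [inner_add_left, real_inner_smul_left]
        linarith [mul_nonpos_of_nonneg_of_nonpos (k.cast_nonneg (α := ℝ))
          (hA.inner_nonpos hv hy)]
      have h := hz _ hmem
      rw [dotp_eq_inner, real_inner_comm, inner_add_left, real_inner_smul_left] at h
      linarith
  · intro y hy x hx
    have h := hx y hy
    rwa [dotp_eq_inner, real_inner_comm, ← dotp_eq_inner] at h
end
end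

section
/- Let P₀, P₁ ∈ CC₊ with P₀ ≠ R̄₊ⁿ and P₁ ≠ R̄₊ⁿ, and let t ∈ (0,1). Then the covolume of the copolar combination satisfies Covol(P_t^⊕) ≤ (1−t)·Covol(P₀) + t·Covol(P₁), where P_t^⊕ = ((1−t)P₀° + tP₁°)°. -/
open Set MeasureTheory Pointwise

noncomputable section

lemma isClosed_posOrthantCl (n : ℕ) : IsClosed (posOrthantCl n) := by
  simp only [posOrthantCl, ofPred_forall]
  exact isClosed_iInter fun i => isClosed_le continuous_const (by fun_prop)

lemma smul_mem_posOrthantCl {n : ℕ} {s : ℝ} (hs : 0 ≤ s) {x : En n} (hx : x ∈ posOrthantCl n) :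
    s • x ∈ posOrthantCl n := fun i => by
  simpa using mul_nonneg hs (hx i)

lemma dotp_add_left {n : ℕ} (x y z : En n) : dotp (x + y) z = dotp x z + dotp y z := by
  simp [dotp, add_mul, Finset.sum_add_distrib]

lemma dotp_smul_left {n : ℕ} (s : ℝ) (x y : En n) : dotp (s • x) y = s * dotp x y := by
  simp [dotp, Finset.mul_sum, mul_assoc]

lemma dotp_comm {n : ℕ} (x y : En n) : dotp x y = dotp y x := by
  simp [dotp, mul_comm]

lemma continuous_dotp_left {n : ℕ} (y : En n) : Continuous fun x => dotp x y := by
  unfold dotp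
  fun_prop

lemma memCCplus.nonempty {n : ℕ} (hn : 1 ≤ n) {P : Set (En n)} (h : memCCplus P) :
    P.Nonempty := by
  rw [nonempty_iff_ne_empty]
  rintro rfl
  obtain ⟨C, hC⟩ := h.2.exists_norm_le
  have hmem : EuclideanSpace.single (⟨0, hn⟩ : Fin n) (|C| + 1) ∈ posOrthantCl n \ ∅ := by
    refine ⟨fun i => ?_, notMem_empty _⟩
    rw [PiLp.single_apply]
    split_ifs <;> positivity
  have := hC _ hmem
  rw [PiLp.norm_single, Real.norm_of_nonneg (by positivity)] at this
  linarith [le_abs_self C]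

/-- Elements of the copolar of a nonempty complete set pair nonpositively with the orthant. -/
lemma dotp_nonpos_of_mem_copolar {n : ℕ} {P : Set (En n)} (hP : memCplus P) (hne : P.Nonempty)
    {x y : En n} (hx : x ∈ posOrthantCl n) (hy : y ∈ copolar P) : dotp x y ≤ 0 := by
  obtain ⟨p, hp⟩ := hne
  have hop : ∀ z ∈ posOrthantOp n, dotp z y ≤ 0 := by
    intro z hz
    by_contra! hpos
    obtain ⟨N, hN⟩ := exists_nat_gt (|dotp p y| / dotp z y)
    rw [div_lt_iff₀ hpos] at hN
    have hmem : p + ((N : ℝ) + 1) • z ∈ P :=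
      hP.2.2.2 (add_mem_add hp fun i => by
        simpa using mul_pos (by positivity : (0 : ℝ) < (N : ℝ) + 1) (hz i))
    have := hy _ hmem
    rw [dotp_comm, dotp_add_left, dotp_smul_left] at this
    linarith [neg_abs_le (dotp p y)]
  let e : En n := WithLp.toLp 2 fun _ => 1
  have htend : Filter.Tendsto (fun ε : ℝ => dotp (x + ε • e) y) (nhdsWithin 0 (Ioi 0))
      (nhds (dotp x y)) := by
    have hc : Continuous fun ε : ℝ => dotp (x + ε • e) y :=
      (continuous_dotp_left y).comp (by fun_prop)
    simpa using (hc.tendsto 0).mono_left nhdsWithin_le_nhds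
  refine le_of_tendsto htend ?_
  filter_upwards [self_mem_nhdsWithin] with ε hε
  refine hop _ fun i => ?_
  have hε : 0 < ε := hε
  simpa [e] using add_pos_of_nonneg_of_pos (hx i) hε

/-- The negated support function of `L`, truncated at `0` pointwise so that the infimum is
bounded below. -/
def negSupp {n : ℕ} (L : Set (En n)) (x : En n) : ℝ := ⨅ y : L, max 0 (-dotp x y)

lemma bddBelow_negSupp {n : ℕ} (L : Set (En n)) (x : En n) :
    BddBelow (range fun y : L => max 0 (-dotp x y)) :=
  ⟨0, by rintro _ ⟨y, rfl⟩; exact le_max_left _ _⟩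

lemma negSupp_nonneg {n : ℕ} (L : Set (En n)) (x : En n) : 0 ≤ negSupp L x :=
  Real.iInf_nonneg fun _ => le_max_left _ _

lemma negSupp_smul {n : ℕ} (L : Set (En n)) {s : ℝ} (hs : 0 < s) (x : En n) :
    negSupp L (s • x) = s * negSupp L x := by
  simp only [negSupp, Real.mul_iInf_of_nonneg hs.le, mul_max_of_nonneg _ _ hs.le,
    dotp_smul_left, mul_zero, mul_neg]

lemma measurable_negSupp {n : ℕ} (L : Set (En n)) : Measurable (negSupp L) := by
  refine UpperSemicontinuous.measurable ?_
  refine upperSemicontinuous_ciInf (fun x => bddBelow_negSupp L x) fun y => ?_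
  exact (continuous_const.max (continuous_dotp_left (y : En n)).neg).upperSemicontinuous

lemma negSupp_le {n : ℕ} {L : Set (En n)} {x y : En n} (hy : y ∈ L) (h : dotp x y ≤ 0) :
    negSupp L x ≤ -dotp x y := by
  have := ciInf_le (bddBelow_negSupp L x) ⟨y, hy⟩
  rwa [max_eq_right (by simpa using h)] at this

lemma notMem_of_negSupp_copolar_lt_one {n : ℕ} {P : Set (En n)} (hne : (copolar P).Nonempty)
    {x : En n} (hx : negSupp (copolar P) x < 1) : x ∉ P := by
  intro hxP
  have : Nonempty (copolar P) := hne.to_subtype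
  obtain ⟨⟨y, hy⟩, hlt⟩ := exists_lt_of_ciInf_lt hx
  have h1 := hy x hxP
  have h2 := (le_max_right _ _).trans_lt hlt
  rw [dotp_comm] at h2
  linarith

/-- The integral over `(0, 1)` of `(1 - u) ^ n`, as an extended nonnegative real. -/
def truncConst (n : ℕ) : ENNReal := ∫⁻ u in Ioo (0 : ℝ) 1, ENNReal.ofReal ((1 - u) ^ n)

lemma truncConst_ne_zero (n : ℕ) : truncConst n ≠ 0 := by
  refine (setLIntegral_pos_iff (by fun_prop)).2 ?_ |>.ne'
  have : Function.support (fun u : ℝ => ENNReal.ofReal ((1 - u) ^ n)) ∩ Ioo 0 1 = Ioo 0 1 := by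
    refine inter_eq_right.2 fun u hu => ?_
    have : 0 < (1 - u) ^ n := pow_pos (by linarith [hu.2]) n
    simpa using this
  rw [this]
  simp

lemma truncConst_ne_top (n : ℕ) : truncConst n ≠ ⊤ := by
  refine ((setLIntegral_mono (g := fun _ => 1) measurable_const fun u hu => ?_).trans_lt ?_).ne
  · exact ENNReal.ofReal_le_one.2
      (pow_le_one₀ (by linarith [hu.2]) (by linarith [hu.1]))
  · simp

/-- For a positively homogeneous function `f ≥ 0`, the volume of the part of the orthant where
`f < 1` is proportional to the integral of `max 0 (1 - f)`. -/
lemma lintegral_max_one_sub {n : ℕ} {f : En n → ℝ} (hf : Measurable f) (h0 : ∀ x, 0 ≤ f x)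
    (hs : ∀ s : ℝ, 0 < s → ∀ x, f (s • x) = s * f x) :
    ∫⁻ x in posOrthantCl n, ENNReal.ofReal (max 0 (1 - f x))
      = truncConst n * volume ({x | f x < 1} ∩ posOrthantCl n) := by
  have hmeas : Measurable fun x => max 0 (1 - f x) := by fun_prop
  rw [lintegral_eq_lintegral_meas_lt (f := fun x => max 0 (1 - f x)) _ (Filter.Eventually.of_forall fun x => le_max_left _ _)
    hmeas.aemeasurable, truncConst, ← lintegral_mul_const _ (by fun_prop)]
  rw [← lintegral_indicator measurableSet_Ioi, ← lintegral_indicator measurableSet_Ioo]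
  congr 1
  ext u
  by_cases hu0 : 0 < u
  swap
  · simp [indicator, hu0]
  rw [indicator_of_mem (show u ∈ Ioi (0 : ℝ) from hu0),
    Measure.restrict_apply (measurableSet_lt measurable_const hmeas)]
  by_cases hu1 : u < 1
  · have hpos : 0 < 1 - u := by linarith
    rw [indicator_of_mem (show u ∈ Ioo (0 : ℝ) 1 from ⟨hu0, hu1⟩)]
    have hset : {x | u < max 0 (1 - f x)} ∩ posOrthantCl n
        = (1 - u) • ({x | f x < 1} ∩ posOrthantCl n) := by
      ext x
      rw [mem_smul_set_iff_inv_smul_mem₀ hpos.ne']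
      have hinv : 0 < (1 - u)⁻¹ := inv_pos.2 hpos
      have horth : (1 - u)⁻¹ • x ∈ posOrthantCl n ↔ x ∈ posOrthantCl n := by
        refine ⟨fun h => ?_, smul_mem_posOrthantCl hinv.le⟩
        simpa [smul_smul, hpos.ne'] using smul_mem_posOrthantCl hpos.le h
      simp only [mem_inter_iff, mem_ofPred_eq, horth, hs _ hinv, lt_max_iff, hu0.not_gt, false_or,
        inv_mul_lt_iff₀ hpos, mul_one]
      refine and_congr_left fun _ => ?_
      constructor <;> intro h <;> linarith
    rw [hset, Measure.addHaar_smul, abs_of_nonneg (by positivity)]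
    simp
  · rw [indicator_of_notMem fun h => hu1 h.2]
    have hset : {x | u < max 0 (1 - f x)} = ∅ := by
      ext x
      simp only [mem_ofPred_eq, lt_max_iff, mem_empty_iff_false, iff_false, not_or, not_lt]
      exact ⟨hu0.le, by linarith [h0 x]⟩
    rw [hset, empty_inter, measure_empty]

/-- The volume of the part of the orthant where `f < 1` is a convex functional of the
positively homogeneous function `f ≥ 0`. -/
lemma volume_lt_one_convex_combination_le {n : ℕ} {f g : En n → ℝ}
    (hf : Measurable f) (hg : Measurable g) (hf0 : ∀ x, 0 ≤ f x) (hg0 : ∀ x, 0 ≤ g x)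
    (hfs : ∀ s : ℝ, 0 < s → ∀ x, f (s • x) = s * f x)
    (hgs : ∀ s : ℝ, 0 < s → ∀ x, g (s • x) = s * g x)
    {a b : ℝ} (ha : 0 ≤ a) (hb : 0 ≤ b) (hab : a + b = 1) :
    volume ({x | a * f x + b * g x < 1} ∩ posOrthantCl n)
      ≤ ENNReal.ofReal a * volume ({x | f x < 1} ∩ posOrthantCl n)
        + ENNReal.ofReal b * volume ({x | g x < 1} ∩ posOrthantCl n) := by
  rw [← ENNReal.mul_le_mul_iff_right (truncConst_ne_zero n) (truncConst_ne_top n), mul_add,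
    mul_left_comm, mul_left_comm (truncConst n) (ENNReal.ofReal b),
    ← lintegral_max_one_sub hf hf0 hfs, ← lintegral_max_one_sub hg hg0 hgs,
    ← lintegral_max_one_sub (f := fun x => a * f x + b * g x) (by fun_prop)
      (fun x => add_nonneg (mul_nonneg ha (hf0 x)) (mul_nonneg hb (hg0 x)))
      (fun s hs x => by rw [hfs s hs, hgs s hs]; ring),
    ← lintegral_const_mul _ (by fun_prop), ← lintegral_const_mul _ (by fun_prop),
    ← lintegral_add_left (by fun_prop)]
  refine lintegral_mono fun x => ?_
  rw [← ENNReal.ofReal_mul ha, ← ENNReal.ofReal_mul hb,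
    ← ENNReal.ofReal_add (mul_nonneg ha (le_max_left _ _)) (mul_nonneg hb (le_max_left _ _))]
  refine ENNReal.ofReal_le_ofReal (max_le ?_ ?_)
  · exact add_nonneg (mul_nonneg ha (le_max_left _ _)) (mul_nonneg hb (le_max_left _ _))
  · have h1 := mul_le_mul_of_nonneg_left (le_max_right 0 (1 - f x)) ha
    have h2 := mul_le_mul_of_nonneg_left (le_max_right 0 (1 - g x)) hb
    linarith

/-- For P₀, P₁ ∈ CC₊ different from R̄₊ⁿ and t ∈ (0,1),
Covol(P_t^⊕) ≤ (1−t)·Covol(P₀) + t·Covol(P₁), where P_t^⊕ = ((1−t)P₀° + tP₁°)°. -/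
theorem covol_copolar_combination_le (n : ℕ) (hn : 1 ≤ n) (P0 P1 : Set (En n))
    (h0 : memCCplus P0) (h1 : memCCplus P1)
    (h0' : P0 ≠ posOrthantCl n) (h1' : P1 ≠ posOrthantCl n)
    (t : ℝ) (ht : t ∈ Set.Ioo (0:ℝ) 1) :
    volume (posOrthantCl n \ copolar ((1 - t) • copolar P0 + t • copolar P1))
      ≤ ENNReal.ofReal (1 - t) * volume (posOrthantCl n \ P0)
        + ENNReal.ofReal t * volume (posOrthantCl n \ P1) := by
  rw [mem_Ioo] at ht
  have ht0 : 0 ≤ t := ht.1.le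
  have ht1 : 0 ≤ 1 - t := by linarith
  have hn0 := h0.nonempty hn
  have hn1 := h1.nonempty hn
  rcases (copolar P0).eq_empty_or_nonempty with he0 | hne0
  · have : copolar (∅ : Set (En n)) = univ := by simp [copolar]
    simp [he0, this]
  rcases (copolar P1).eq_empty_or_nonempty with he1 | hne1
  · have : copolar (∅ : Set (En n)) = univ := by simp [copolar]
    simp [he1, this]
  refine (measure_mono ?_).trans
    ((volume_lt_one_convex_combination_le (measurable_negSupp (copolar P0))
      (measurable_negSupp (copolar P1)) (negSupp_nonneg _) (negSupp_nonneg _)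
      (fun s hs x => negSupp_smul _ hs x) (fun s hs x => negSupp_smul _ hs x)
      ht1 ht0 (by ring)).trans ?_)
  · rintro x ⟨hx, hxt⟩
    refine ⟨?_, hx⟩
    by_contra hlt
    refine hxt ?_
    rintro _ ⟨_, ⟨y, hy, rfl⟩, _, ⟨z, hz, rfl⟩, rfl⟩
    have hy' := negSupp_le hy (dotp_nonpos_of_mem_copolar h0.1 hn0 hx hy)
    have hz' := negSupp_le hz (dotp_nonpos_of_mem_copolar h1.1 hn1 hx hz)
    have e : dotp x ((1 - t) • y + t • z) = (1 - t) * dotp x y + t * dotp x z := by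
      rw [dotp_comm, dotp_add_left, dotp_smul_left, dotp_smul_left, dotp_comm y, dotp_comm z]
    rw [mem_ofPred_eq, not_lt] at hlt
    have h2 := mul_le_mul_of_nonneg_left hy' ht1
    have h3 := mul_le_mul_of_nonneg_left hz' ht0
    simp only [e]
    linarith
  · gcongr
    · exact fun x hx => ⟨hx.2, notMem_of_negSupp_copolar_lt_one hne0 hx.1⟩
    · exact fun x hx => ⟨hx.2, notMem_of_negSupp_copolar_lt_one hne1 hx.1⟩
end
end
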